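/- arXiv:1409.2387 — 6 statements merged into one kernel-verified Lean document; each statement's English description precedes it below -/
import Mathlib

section
/- Let δ > 0, let b : (0,δ] → ℝ be continuous, fix x₀ ∈ (0,δ) and set ρ(x) := exp(−∫_{x₀}^x 2b(s) ds). Assume ∫₀^δ ρ(s)⁻¹ ds < ∞. Let z ∈ ℂ and let u : [0,δ] → ℂ be continuous and nowhere vanishing, twice continuously differentiable on (0,δ), with −(1/2)u'' + b u' = z u on (0,δ). Define φ(x) := u(x) ∫₀^x u(s)⁻² ρ(s)⁻¹ ds for x ∈ (0,δ). Then φ is twice continuously differentiable on (0,δ), satisfies −(1/2)φ'' + b φ' = z φ on (0,δ), lim_{x→0⁺} φ(x) = 0, and ρ(x)(u(x)φ'(x) − u'(x)φ(x)) = 1 for all x ∈ (0,δ); in particular u and φ are linearly independent solutions. -/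
open MeasureTheory Set Filter

/-- Reduction of order: from a nowhere vanishing solution `u` of `-(1/2)u'' + b u' = z u`
one builds a second solution `φ(x) = u(x)∫₀ˣ u⁻² ρ⁻¹` vanishing at `0`, with Wronskian
`ρ(uφ' - u'φ) ≡ 1`; in particular `u` and `φ` are linearly independent. -/
theorem reduction_of_order_second_solution (δ : ℝ) (hδ : 0 < δ)
    (b : ℝ → ℝ) (hb : ContinuousOn b (Ioc 0 δ))
    (x₀ : ℝ) (hx₀ : x₀ ∈ Ioo 0 δ)
    (ρ : ℝ → ℝ) (hρ : ∀ x, ρ x = Real.exp (-∫ s in x₀..x, 2 * b s))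
    (hρint : IntegrableOn (fun s => (ρ s)⁻¹) (Ioc 0 δ))
    (z : ℂ) (u : ℝ → ℂ) (hu : ContinuousOn u (Icc 0 δ))
    (hune : ∀ x ∈ Icc (0:ℝ) δ, u x ≠ 0)
    (u' u'' : ℝ → ℂ)
    (hu' : ∀ x ∈ Ioo (0:ℝ) δ, HasDerivAt u (u' x) x)
    (hu'' : ∀ x ∈ Ioo (0:ℝ) δ, HasDerivAt u' (u'' x) x)
    (hu''c : ContinuousOn u'' (Ioo 0 δ))
    (hode : ∀ x ∈ Ioo (0:ℝ) δ, -(1/2 : ℂ) * u'' x + (b x : ℂ) * u' x = z * u x)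
    (φ : ℝ → ℂ)
    (hφ : ∀ x, φ x = u x * ∫ s in Ioc 0 x, ((u s) ^ 2)⁻¹ * ((ρ s : ℂ))⁻¹) :
    ∃ φ' φ'' : ℝ → ℂ,
      (∀ x ∈ Ioo (0:ℝ) δ, HasDerivAt φ (φ' x) x) ∧
      (∀ x ∈ Ioo (0:ℝ) δ, HasDerivAt φ' (φ'' x) x) ∧
      ContinuousOn φ'' (Ioo 0 δ) ∧
      (∀ x ∈ Ioo (0:ℝ) δ, -(1/2 : ℂ) * φ'' x + (b x : ℂ) * φ' x = z * φ x) ∧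
      Tendsto φ (nhdsWithin 0 (Ioi 0)) (nhds 0) ∧
      (∀ x ∈ Ioo (0:ℝ) δ, (ρ x : ℂ) * (u x * φ' x - u' x * φ x) = 1) ∧
      (∀ c d : ℂ, (∀ x ∈ Ioo (0:ℝ) δ, c * u x + d * φ x = 0) → c = 0 ∧ d = 0) := by
  have hρpos : ∀ x, (ρ x : ℂ) ≠ 0 := fun x => by
    rw [hρ]; exact_mod_cast (Real.exp_pos _).ne'
  have hmem : ∀ x ∈ Ioo (0:ℝ) δ, Ioo (0:ℝ) δ ∈ nhds x := fun x hx => Ioo_mem_nhds hx.1 hx.2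
  have hbo : ContinuousOn (fun s => 2 * b s) (Ioo 0 δ) :=
    (continuousOn_const.mul hb).mono Ioo_subset_Ioc_self
  have hρd : ∀ x ∈ Ioo (0:ℝ) δ, HasDerivAt ρ (-(2 * b x) * ρ x) x := by
    intro x hx
    have hsub : uIcc x₀ x ⊆ Ioo 0 δ := ordConnected_Ioo.uIcc_subset hx₀ hx
    have h1 : HasDerivAt (fun y => ∫ s in x₀..y, 2 * b s) (2 * b x) x :=
      intervalIntegral.integral_hasDerivAt_right (hbo.mono hsub).intervalIntegrable
        (hbo.stronglyMeasurableAtFilter isOpen_Ioo x hx) (hbo.continuousAt (hmem x hx))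
    have h2 := h1.neg.exp
    have h3 : ρ = fun y => Real.exp (-∫ s in x₀..y, 2 * b s) := funext hρ
    rw [h3]
    exact h2.congr_deriv (mul_comm _ _)
  have hρc : ∀ x ∈ Ioo (0:ℝ) δ, HasDerivAt (fun y => (ρ y : ℂ)) (-(2 * (b x : ℂ)) * ρ x) x := by
    intro x hx
    have := (hρd x hx).ofReal_comp
    convert this using 1
    push_cast; ring
  obtain ⟨g, hg⟩ : ∃ g : ℝ → ℂ, g = fun s => ((u s) ^ 2)⁻¹ * ((ρ s : ℂ))⁻¹ := ⟨_, rfl⟩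
  obtain ⟨J, hJ⟩ : ∃ J : ℝ → ℂ, J = fun x => ∫ s in Ioc 0 x, g s := ⟨_, rfl⟩
  have hφJ : φ = fun x => u x * J x := by
    funext x; rw [hφ, hJ, hg]
  have hgint : IntegrableOn g (Icc 0 δ) := by
    have h1 : IntegrableOn (fun s => ((ρ s : ℂ))⁻¹) (Icc 0 δ) := by
      rw [integrableOn_Icc_iff_integrableOn_Ioc]
      have := Integrable.ofReal (𝕜 := ℂ) hρint
      simpa [IntegrableOn] using this
    rw [hg]
    refine IntegrableOn.continuousOn_mul (g := fun s => ((u s) ^ 2)⁻¹) ?_ h1 isCompact_Icc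
    exact (hu.pow 2).inv₀ (fun x hx => pow_ne_zero 2 (hune x hx))
  have hgd : ∀ x ∈ Ioo (0:ℝ) δ,
      HasDerivAt g (-2 * u' x / u x * g x + 2 * (b x : ℂ) * g x) x := by
    intro x hx
    have hux := hune x (Ioo_subset_Icc_self hx)
    have h1 := (((hu' x hx).pow 2).inv (pow_ne_zero 2 hux)).mul ((hρc x hx).inv (hρpos x))
    have hρx := hρpos x
    rw [hg]
    refine h1.congr_deriv ?_
    simp
    field_simp
  have hJc : ContinuousOn J (Icc 0 δ) := by
    rw [hJ]; exact intervalIntegral.continuousOn_primitive hgint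
  have hgc : ContinuousOn g (Ioo 0 δ) := fun x hx => (hgd x hx).continuousAt.continuousWithinAt
  have hJd : ∀ x ∈ Ioo (0:ℝ) δ, HasDerivAt J (g x) x := by
    intro x hx
    have h1 : HasDerivAt (fun y => ∫ s in (0:ℝ)..y, g s) (g x) x := by
      refine intervalIntegral.integral_hasDerivAt_right ?_
        (hgc.stronglyMeasurableAtFilter isOpen_Ioo x hx) (hgc.continuousAt (hmem x hx))
      rw [intervalIntegrable_iff_integrableOn_Icc_of_le hx.1.le]
      exact hgint.mono_set (Icc_subset_Icc_right hx.2.le)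
    refine h1.congr_of_eventuallyEq ?_
    filter_upwards [hmem x hx] with y hy
    rw [hJ, intervalIntegral.integral_of_le hy.1.le]
  have hφd : ∀ x ∈ Ioo (0:ℝ) δ, HasDerivAt φ (u' x * J x + u x * g x) x := by
    intro x hx
    rw [hφJ]
    exact (hu' x hx).mul (hJd x hx)
  have hW : ∀ x ∈ Ioo (0:ℝ) δ,
      (ρ x : ℂ) * (u x * (u' x * J x + u x * g x) - u' x * φ x) = 1 := by
    intro x hx
    have hux := hune x (Ioo_subset_Icc_self hx)
    have hρx := hρpos x
    rw [hφJ, hg]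
    field_simp
    ring
  refine ⟨fun x => u' x * J x + u x * g x, fun x => u'' x * J x + 2 * (b x : ℂ) * u x * g x,
    hφd, ?_, ?_, ?_, ?_, hW, ?_⟩
  · intro x hx
    have hux := hune x (Ioo_subset_Icc_self hx)
    have h1 := ((hu'' x hx).mul (hJd x hx)).add ((hu' x hx).mul (hgd x hx))
    refine h1.congr_deriv ?_
    field_simp
    ring
  · have hbc : ContinuousOn (fun x => (b x : ℂ)) (Ioo 0 δ) :=
      Complex.continuous_ofReal.comp_continuousOn (hb.mono Ioo_subset_Ioc_self)
    exact (hu''c.mul (hJc.mono Ioo_subset_Icc_self)).add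
      (((continuousOn_const.mul hbc).mul (hu.mono Ioo_subset_Icc_self)).mul hgc)
  · intro x hx
    rw [hφJ]
    linear_combination J x * hode x hx
  · have h0 : (0:ℝ) ∈ Icc 0 δ := ⟨le_rfl, hδ.le⟩
    have h1 : ContinuousWithinAt φ (Icc 0 δ) 0 := by
      rw [hφJ]; exact (hu.mul hJc) 0 h0
    have h2 : φ 0 = 0 := by rw [hφ]; simp
    have h3 := h1.tendsto
    rw [h2] at h3
    refine h3.mono_left ?_
    rw [← nhdsWithin_Ioc_eq_nhdsGT hδ]
    exact nhdsWithin_mono _ Ioc_subset_Icc_self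
  · intro c d h
    have hux := hune x₀ (Ioo_subset_Icc_self hx₀)
    have h1 : HasDerivAt (fun x => c * u x + d * φ x)
        (c * u' x₀ + d * (u' x₀ * J x₀ + u x₀ * g x₀)) x₀ :=
      ((hu' x₀ hx₀).const_mul c).add ((hφd x₀ hx₀).const_mul d)
    have h2 : HasDerivAt (fun x => c * u x + d * φ x) 0 x₀ := by
      refine (hasDerivAt_const x₀ (0:ℂ)).congr_of_eventuallyEq ?_
      filter_upwards [hmem x₀ hx₀] with y hy using h y hy
    have h3 := h1.unique h2
    have h4 := h x₀ hx₀
    have hd : d = 0 := by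
      linear_combination (-d) * hW x₀ hx₀ + (ρ x₀ : ℂ) * u x₀ * h3 - (ρ x₀ : ℂ) * u' x₀ * h4
    refine ⟨?_, hd⟩
    rw [hd] at h4
    simpa [hux] using h4
end

section
/- Let a > 0, let b : (0,a] → ℝ be continuous, fix x₀ ∈ (0,a) and set ρ(x) := exp(−∫_{x₀}^x 2b(s) ds). Assume ∫₀^a ρ(t)⁻¹ (∫_t^a ρ(s) ds) dt < ∞ and ∫₀^a ρ(t) (∫_t^a ρ(s)⁻¹ ds) dt = ∞ (i.e. 0 is an exit boundary). Let λ > 0 and let v : (0,a] → ℝ be a twice continuously differentiable solution of −(1/2)v'' + b v' = λ v on (0,a] that is not identically zero. Then v has only finitely many zeros in (0,a]. -/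
open MeasureTheory Set

lemma uniq_aux (a lam : ℝ) (b v v' v'' : ℝ → ℝ) (hb : ContinuousOn b (Ioc 0 a))
    (hv' : ∀ x ∈ Ioc (0:ℝ) a, HasDerivAt v (v' x) x)
    (hv'' : ∀ x ∈ Ioc (0:ℝ) a, HasDerivAt v' (v'' x) x)
    (hode : ∀ x ∈ Ioc (0:ℝ) a, -(1/2) * v'' x + b x * v' x = lam * v x)
    (hlam : 0 < lam)
    (c : ℝ) (hc : c ∈ Ioc 0 a) (h0 : v c = 0) (h1 : v' c = 0) :
    ∀ x ∈ Ioc 0 a, v x = 0 := by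
  intro x hx
  have hp : 0 < min x c := lt_min hx.1 hc.1
  have hsub : Icc (min x c) a ⊆ Ioc 0 a := fun y hy => ⟨hp.trans_le hy.1, hy.2⟩
  obtain ⟨B, hB⟩ := isCompact_Icc.exists_bound_of_continuousOn (hb.mono hsub)
  set K := 1 + 4 * B + 2 * lam with hK
  have key : ∀ y ∈ Icc (min x c) a,
      |2 * v y * v' y + 2 * v' y * v'' y| ≤ K * (v y ^ 2 + v' y ^ 2) := by
    intro y hy
    have hBy := abs_le.1 (hB y hy)
    have e : v'' y = 2 * b y * v' y - 2 * lam * v y := by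
      have := hode y (hsub hy); linarith
    have q1 := mul_nonneg (sub_nonneg.2 hBy.2) (sq_nonneg (v' y))
    have q2 := mul_nonneg (neg_le_iff_add_nonneg.1 hBy.1) (sq_nonneg (v' y))
    have q0 := mul_nonneg ((abs_nonneg _).trans (hB y hy)) (sq_nonneg (v y))
    have q3 := mul_nonneg hlam.le (sq_nonneg (v y - v' y))
    have q4 := mul_nonneg hlam.le (sq_nonneg (v y + v' y))
    have q5 := sq_nonneg (v y - v' y)
    have q6 := sq_nonneg (v y + v' y)
    have q7 := mul_nonneg ((abs_nonneg _).trans (hB y hy)) (sq_nonneg (v' y))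
    rw [abs_le, e, hK]
    constructor <;> nlinarith
  have hE : ∀ s : ℝ, ∀ y ∈ Icc (min x c) a,
      HasDerivAt (fun y => (v y ^ 2 + v' y ^ 2) * Real.exp (s * y))
        ((2 * v y * v' y + 2 * v' y * v'' y + s * (v y ^ 2 + v' y ^ 2)) * Real.exp (s * y)) y := by
    intro s y hy
    have d1 := (hv' y (hsub hy)).pow 2
    have d2 := (hv'' y (hsub hy)).pow 2
    have d3 := ((hasDerivAt_id y).const_mul s).exp
    refine ((d1.add d2).mul d3).congr_deriv ?_
    simp
    ring
  have hxm : x ∈ Icc (min x c) a := ⟨min_le_left _ _, hx.2⟩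
  have hcm : c ∈ Icc (min x c) a := ⟨min_le_right _ _, hc.2⟩
  have fin : ∀ s : ℝ, (v x ^ 2 + v' x ^ 2) * Real.exp (s * x) ≤
      (v c ^ 2 + v' c ^ 2) * Real.exp (s * c) → v x = 0 := by
    intro s h
    rw [h0, h1] at h
    have := Real.exp_pos (s * x)
    have : v x ^ 2 + v' x ^ 2 ≤ 0 := by
      by_contra hcon
      push Not at hcon
      have := mul_pos hcon this
      simp at h
      linarith
    nlinarith [sq_nonneg (v x), sq_nonneg (v' x)]
  rcases le_total x c with hxc | hxc
  · have mono : MonotoneOn (fun y => (v y ^ 2 + v' y ^ 2) * Real.exp (K * y)) (Icc (min x c) a) := by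
      refine monotoneOn_of_deriv_nonneg (convex_Icc _ _)
        (fun y hy => (hE K y hy).continuousAt.continuousWithinAt)
        (fun y hy => (hE K y (interior_subset hy)).differentiableAt.differentiableWithinAt) ?_
      intro y hy
      have hy := interior_subset hy
      rw [(hE K y hy).deriv]
      have := abs_le.1 (key y hy)
      exact mul_nonneg (by linarith) (Real.exp_pos _).le
    exact fin K (mono hxm hcm hxc)
  · have mono : AntitoneOn (fun y => (v y ^ 2 + v' y ^ 2) * Real.exp (-K * y)) (Icc (min x c) a) := by
      refine antitoneOn_of_deriv_nonpos (convex_Icc _ _)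
        (fun y hy => (hE (-K) y hy).continuousAt.continuousWithinAt)
        (fun y hy => (hE (-K) y (interior_subset hy)).differentiableAt.differentiableWithinAt) ?_
      intro y hy
      have hy := interior_subset hy
      rw [(hE (-K) y hy).deriv]
      have := abs_le.1 (key y hy)
      exact mul_nonpos_of_nonpos_of_nonneg (by linarith) (Real.exp_pos _).le
    exact fin (-K) (mono hcm hxm hxc)

/-- If `0` is an exit boundary, every nontrivial solution of the eigenvalue equation
`-(1/2)v'' + b v' = λ v` with `λ > 0` has only finitely many zeros in `(0,a]`. -/
theorem finitely_many_zeros_of_exit_boundary (a : ℝ) (ha : 0 < a)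
    (b : ℝ → ℝ) (hb : ContinuousOn b (Ioc 0 a))
    (x₀ : ℝ) (hx₀ : x₀ ∈ Ioo 0 a)
    (ρ : ℝ → ℝ) (hρ : ∀ x, ρ x = Real.exp (-∫ s in x₀..x, 2 * b s))
    (hexit1 : IntegrableOn (fun t => (ρ t)⁻¹ * ∫ s in Ioc t a, ρ s) (Ioc 0 a))
    (hexit2 : ¬ IntegrableOn (fun t => ρ t * ∫ s in Ioc t a, (ρ s)⁻¹) (Ioc 0 a))
    (lam : ℝ) (hlam : 0 < lam)
    (v v' v'' : ℝ → ℝ)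
    (hv' : ∀ x ∈ Ioc (0:ℝ) a, HasDerivAt v (v' x) x)
    (hv'' : ∀ x ∈ Ioc (0:ℝ) a, HasDerivAt v' (v'' x) x)
    (hv''c : ContinuousOn v'' (Ioc 0 a))
    (hode : ∀ x ∈ Ioc (0:ℝ) a, -(1/2) * v'' x + b x * v' x = lam * v x)
    (hnontriv : ∃ x ∈ Ioc (0:ℝ) a, v x ≠ 0) :
    {x ∈ Ioc (0:ℝ) a | v x = 0}.Finite := by
  have hnu : ∀ c ∈ Ioc 0 a, v c = 0 → v' c ≠ 0 := by
    intro c hc h0 h1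
    obtain ⟨x, hx, hne⟩ := hnontriv
    exact hne (uniq_aux a lam b v v' v'' hb hv' hv'' hode hlam c hc h0 h1 x hx)
  have hρpos : ∀ x, 0 < ρ x := fun x => by rw [hρ]; exact Real.exp_pos _
  have hbi : ∀ p q, p ∈ Ioc 0 a → q ∈ Ioc 0 a → IntervalIntegrable (fun s => 2 * b s) volume p q := by
    intro p q hp hq
    apply ContinuousOn.intervalIntegrable
    refine (continuousOn_const.mul hb).mono fun y hy => ?_
    exact (ordConnected_Ioc.uIcc_subset hp hq) hy
  have hx₀' : x₀ ∈ Ioc 0 a := ⟨hx₀.1, hx₀.2.le⟩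
  have haa : a ∈ Ioc 0 a := ⟨ha, le_rfl⟩
  have hρc : ∀ t ∈ Ioc 0 a, ContinuousOn ρ (Icc t a) := by
    intro t ht
    have hm : min t x₀ ∈ Ioc 0 a := ⟨lt_min ht.1 hx₀.1, (min_le_left _ _).trans ht.2⟩
    have := intervalIntegral.continuousOn_primitive_interval' (a := x₀) (hbi _ _ hm haa)
      (by rw [uIcc_of_le hm.2]; exact ⟨min_le_right _ _, hx₀.2.le⟩)
    rw [uIcc_of_le hm.2] at this
    have h2 := (this.mono (Icc_subset_Icc_left (min_le_left t x₀))).neg.rexp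
    exact h2.congr fun y _ => hρ y
  have hρd : ∀ t ∈ Ioo 0 a, HasDerivAt ρ (-(2 * b t) * ρ t) t := by
    intro t ht
    have hc : ContinuousOn (fun s => 2 * b s) (Ioo 0 a) :=
      (continuousOn_const.mul hb).mono Ioo_subset_Ioc_self
    have := intervalIntegral.integral_hasDerivAt_right (hbi x₀ t hx₀' ⟨ht.1, ht.2.le⟩)
      (hc.stronglyMeasurableAtFilter isOpen_Ioo t ht) (hc.continuousAt (isOpen_Ioo.mem_nhds ht))
    have h2 := this.neg.exp
    have e : ρ = fun x => Real.exp (-∫ s in x₀..x, 2 * b s) := funext hρ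
    rw [e]
    exact h2.congr_deriv (mul_comm _ _)
  set F : ℝ → ℝ := fun t => (ρ t)⁻¹ * ∫ s in Ioc t a, ρ s with hF
  have hF0 : ∀ t, 0 ≤ F t := fun t => mul_nonneg (inv_nonneg.2 (hρpos t).le)
    (integral_nonneg fun s => (hρpos s).le)
  obtain ⟨δ, hδ, hδa, hδF⟩ : ∃ δ, 0 < δ ∧ δ < a ∧ 2 * lam * (∫ t in (0:ℝ)..δ, F t) < 1 := by
    have hii : IntervalIntegrable F volume 0 a :=
      (intervalIntegrable_iff_integrableOn_Ioc_of_le ha.le).2 hexit1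
    have hc := intervalIntegral.continuousOn_primitive_interval' (a := 0) hii left_mem_uIcc
    rw [uIcc_of_le ha.le] at hc
    have h0 := (hc 0 ⟨le_rfl, ha.le⟩).const_mul (2 * lam)
    have h1 := (h0.mono_left (nhdsWithin_mono 0 (Ioo_subset_Icc_self))).eventually_lt_const
      (u := 1) (by simp)
    rw [nhdsWithin_Ioo_eq_nhdsGT ha] at h1
    obtain ⟨d, h, h'⟩ := (h1.and (Ioo_mem_nhdsGT ha)).exists
    exact ⟨d, h'.1, h'.2, h⟩
  have hone : ∀ x y, 0 < x → x < y → y ≤ δ → v x = 0 → v y = 0 → False := by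
    intro x y hx hxy hyδ hvx hvy
    have hsub : Icc x y ⊆ Ioo 0 a := fun z hz => ⟨hx.trans_le hz.1, hz.2.trans_lt (hyδ.trans_lt hδa)⟩
    have hsub' : Icc x y ⊆ Ioc 0 a := hsub.trans Ioo_subset_Ioc_self
    have hvc : ContinuousOn v (Icc x y) := fun z hz => (hv' z (hsub' hz)).continuousAt.continuousWithinAt
    have hv'c : ContinuousOn v' (Icc x y) :=
      fun z hz => (hv'' z (hsub' hz)).continuousAt.continuousWithinAt
    have hxx : x ∈ Icc x y := ⟨le_rfl, hxy.le⟩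
    obtain ⟨m, hm, hmax⟩ := isCompact_Icc.exists_isMaxOn ⟨x, hxx⟩ hvc.abs
    have hmax' : ∀ z ∈ Icc x y, |v z| ≤ |v m| := fun z hz => hmax hz
    have hvm : v m ≠ 0 := by
      intro h
      have hz : ∀ z ∈ Icc x y, v z = 0 := fun z hz => by
        have := hmax' z hz
        rw [h, abs_zero] at this
        exact abs_eq_zero.1 (le_antisymm this (abs_nonneg _))
      have hmid : (x + y) / 2 ∈ Ioo x y := ⟨by linarith, by linarith⟩
      have hmc := Ioo_subset_Icc_self hmid
      refine hnu _ (hsub' hmc) (hz _ hmc) ?_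
      have h1 : HasDerivAt v 0 ((x + y) / 2) := (hasDerivAt_const _ (0:ℝ)).congr_of_eventuallyEq (by
        filter_upwards [Icc_mem_nhds hmid.1 hmid.2] with z hzz using hz z hzz)
      exact (hv' _ (hsub' hmc)).unique h1
    have hxm : x < m := lt_of_le_of_ne hm.1 (by rintro rfl; exact hvm hvx)
    have hmy : m < y := lt_of_le_of_ne hm.2 (by rintro rfl; exact hvm hvy)
    have hv'm : v' m = 0 := by
      have hl : IsLocalMax (fun z => v z ^ 2) m := by
        filter_upwards [Icc_mem_nhds hxm hmy] with z hz
        exact sq_le_sq.2 (hmax' z hz)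
      have := hl.hasDerivAt_eq_zero ((hv' m (hsub' hm)).pow 2)
      simpa [hvm] using this
    have hsubm : Icc x m ⊆ Icc x y := Icc_subset_Icc_right hmy.le
    have hbound : ∀ t ∈ Icc x m, ‖v' t‖ ≤ 2 * lam * |v m| * F t := by
      intro t ht
      have hta := hsub' (hsubm ht)
      have htm : Icc t m ⊆ Icc x y := Icc_subset_Icc ht.1 hmy.le
      have hma : m ≤ a := (hsub' hm).2
      have hρi : IntegrableOn ρ (Ioc t a) :=
        ((hρc t hta).integrableOn_Icc).mono_set Ioc_subset_Icc_self
      have hftc : ∫ s in t..m, -(2 * lam) * (ρ s * v s) = ρ m * v' m - ρ t * v' t := by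
        apply intervalIntegral.integral_eq_sub_of_hasDerivAt (f := fun s => ρ s * v' s)
        · intro s hs
          rw [uIcc_of_le ht.2] at hs
          have := (hρd s (hsub (htm hs))).mul (hv'' s (hsub' (htm hs)))
          refine this.congr_deriv ?_
          have := hode s (hsub' (htm hs))
          linear_combination (-2 * ρ s) * this
        · apply ContinuousOn.intervalIntegrable
          rw [uIcc_of_le ht.2]
          exact continuousOn_const.mul
            (((hρc t hta).mono (Icc_subset_Icc_right hma)).mul (hvc.mono htm))
      have h1 : ‖∫ s in t..m, -(2 * lam) * (ρ s * v s)‖ ≤ ∫ s in t..m, 2 * lam * |v m| * ρ s := by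
        apply intervalIntegral.norm_integral_le_of_norm_le ht.2
        · refine Filter.Eventually.of_forall fun s hs => ?_
          have := hmax' s (htm (Ioc_subset_Icc_self hs))
          rw [Real.norm_eq_abs, abs_mul, abs_mul, abs_neg, abs_of_pos (hρpos s),
            abs_of_pos (by positivity : 0 < 2 * lam)]
          have h3 := mul_le_mul_of_nonneg_left this (mul_nonneg hlam.le (hρpos s).le)
          nlinarith
        · apply ContinuousOn.intervalIntegrable
          rw [uIcc_of_le ht.2]
          exact continuousOn_const.mul ((hρc t hta).mono (Icc_subset_Icc_right hma))
      have h2 : ∫ s in t..m, ρ s ≤ ∫ s in Ioc t a, ρ s := by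
        rw [intervalIntegral.integral_of_le ht.2]
        exact setIntegral_mono_set hρi (Filter.Eventually.of_forall fun s => (hρpos s).le)
          (Ioc_subset_Ioc_right hma).eventuallyLE
      rw [hftc, hv'm, mul_zero, zero_sub, norm_neg, norm_mul, Real.norm_eq_abs, abs_of_pos (hρpos t),
        intervalIntegral.integral_const_mul] at h1
      have h3 := h1.trans (mul_le_mul_of_nonneg_left h2 (by positivity))
      have : 2 * lam * |v m| * F t = (ρ t)⁻¹ * (2 * lam * |v m| * ∫ s in Ioc t a, ρ s) := by
        rw [hF]; ring
      rw [this, ← div_eq_inv_mul, le_div_iff₀ (hρpos t), mul_comm]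
      exact h3
    have hFi : IntegrableOn F (Ioc 0 δ) := hexit1.mono_set (Ioc_subset_Ioc_right hδa.le)
    have hsF : Ioc x m ⊆ Ioc 0 δ := Ioc_subset_Ioc hx.le (hmy.le.trans hyδ)
    have hftc : ∫ t in x..m, v' t = v m - v x := by
      apply intervalIntegral.integral_eq_sub_of_hasDerivAt
      · intro s hs
        rw [uIcc_of_le hxm.le] at hs
        exact hv' s (hsub' (hsubm hs))
      · apply ContinuousOn.intervalIntegrable
        rw [uIcc_of_le hxm.le]
        exact hv'c.mono hsubm
    have h1 : ‖∫ t in x..m, v' t‖ ≤ ∫ t in x..m, 2 * lam * |v m| * F t := by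
      apply intervalIntegral.norm_integral_le_of_norm_le hxm.le
      · exact Filter.Eventually.of_forall fun s hs => hbound s (Ioc_subset_Icc_self hs)
      · exact ((intervalIntegrable_iff_integrableOn_Ioc_of_le hxm.le).2
          (hFi.mono_set hsF)).const_mul _
    have h2 : ∫ t in x..m, F t ≤ ∫ t in (0:ℝ)..δ, F t := by
      rw [intervalIntegral.integral_of_le hxm.le, intervalIntegral.integral_of_le hδ.le]
      exact setIntegral_mono_set hFi (Filter.Eventually.of_forall hF0) hsF.eventuallyLE
    rw [hftc, hvx, sub_zero, Real.norm_eq_abs, intervalIntegral.integral_const_mul] at h1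
    have hpos := abs_pos.2 hvm
    have h3 := h1.trans (mul_le_mul_of_nonneg_left h2 (by positivity))
    have h4 := mul_lt_mul_of_pos_right hδF hpos
    linarith
  have hfin1 : {x ∈ Ioc (0:ℝ) a | v x = 0 ∧ x ≤ δ}.Finite := by
    apply Set.Subsingleton.finite
    rintro x ⟨hx, hvx, hxδ⟩ y ⟨hy, hvy, hyδ⟩
    rcases lt_trichotomy x y with h | h | h
    · exact (hone x y hx.1 h hyδ hvx hvy).elim
    · exact h
    · exact (hone y x hy.1 h hxδ hvy hvx).elim
  have hfin2 : {x ∈ Icc δ a | v x = 0}.Finite := by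
    by_contra hinf
    obtain ⟨c, hc, hacc⟩ := Set.Infinite.exists_accPt_of_subset_isCompact hinf
      (isCompact_Icc (a := δ) (b := a)) (fun x hx => hx.1)
    have hc' : c ∈ Ioc 0 a := ⟨hδ.trans_le hc.1, hc.2⟩
    have hfr := accPt_iff_frequently_nhdsNE.1 hacc
    have hvc : v c = 0 := by
      by_contra hne
      have := ((hv' c hc').continuousAt.eventually_ne hne).filter_mono
        (nhdsWithin_le_nhds (s := {c}ᶜ))
      obtain ⟨z, hz, hz'⟩ := (hfr.and_eventually this).exists
      exact hz' hz.2
    have := (hv' c hc').eventually_ne (c := 0) (hnu c hc' hvc)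
    obtain ⟨z, hz, hz'⟩ := (hfr.and_eventually this).exists
    exact hz' hz.2
  refine (hfin1.union hfin2).subset ?_
  rintro x ⟨hx, hvx⟩
  rcases le_total x δ with h | h
  · exact Or.inl ⟨hx, hvx, h⟩
  · exact Or.inr ⟨⟨h, hx.2⟩, hvx⟩
end

section
/- Let μ, κ, σ, γ, a > 0 and set C := 2(μ/σ² + γκ/σ⁴) and D := 2κ/σ². Define s'(η) := ((γ+σ²η)/(γ+σ²a))^{−C} e^{D(η−a)} and m(ξ) := ((γ+σ²ξ)/(γ+σ²a))^{C} e^{−D(ξ−a)} / (γξ + σ²ξ²) for ξ, η > 0. Then for every x > 0: (i) lim_{l→0⁺} ∫_l^x m(ξ) dξ = ∞; and (ii) ∫₀^x ( ∫₀^ξ s'(η) dη ) m(ξ) dξ < ∞. -/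
open MeasureTheory Set Filter

/-- Derivative of the scale function of the generalized Feller diffusion
`dN = (μN - κN²)dt + √(γN + σ²N²)dU`. -/
noncomputable def scaleDeriv (μ κ σ γ a η : ℝ) : ℝ :=
  ((γ + σ ^ 2 * η) / (γ + σ ^ 2 * a)) ^ (-(2 * (μ / σ ^ 2 + γ * κ / σ ^ 4))) *
    Real.exp (2 * κ / σ ^ 2 * (η - a))

/-- Speed density of the generalized Feller diffusion. -/
noncomputable def speedDens (μ κ σ γ a ξ : ℝ) : ℝ :=
  ((γ + σ ^ 2 * ξ) / (γ + σ ^ 2 * a)) ^ (2 * (μ / σ ^ 2 + γ * κ / σ ^ 4)) *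
    Real.exp (-(2 * κ / σ ^ 2) * (ξ - a)) / (γ * ξ + σ ^ 2 * ξ ^ 2)

lemma aux_exit (f g m : ℝ → ℝ) (x : ℝ) (hx : 0 < x)
    (hf : ContinuousOn f (Icc 0 x)) (hg : ContinuousOn g (Icc 0 x))
    (hg0 : ∀ t ∈ Icc 0 x, 0 < g t) (hm : ∀ t ∈ Ioc 0 x, m t = g t * t⁻¹) :
    Tendsto (fun l => ∫ t in Ioc l x, m t) (nhdsWithin 0 (Ioi 0)) atTop ∧
    IntegrableOn (fun t => (∫ η in Ioc 0 t, f η) * m t) (Ioc 0 x) := by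
  have hmc : ContinuousOn m (Ioc 0 x) := by
    have h : ContinuousOn (fun t => g t * t⁻¹) (Ioc 0 x) :=
      (hg.mono Ioc_subset_Icc_self).mul
        (continuousOn_id.inv₀ (fun t ht => ne_of_gt ht.1))
    exact h.congr hm
  constructor
  · obtain ⟨t0, ht0, hmin⟩ := isCompact_Icc.exists_isMinOn (nonempty_Icc.2 hx.le) hg
    have hc := hg0 t0 ht0
    have hT : Tendsto (fun l => g t0 * (Real.log x - Real.log l)) (nhdsWithin 0 (Ioi 0)) atTop := by
      apply Tendsto.const_mul_atTop hc
      apply tendsto_atTop_add_const_left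
      exact tendsto_neg_atBot_atTop.comp Real.tendsto_log_nhdsGT_zero
    refine tendsto_atTop_mono' _ ?_ hT
    filter_upwards [Ioo_mem_nhdsGT hx] with l hl
    have hsub : Icc l x ⊆ Ioc 0 x := fun t ht => ⟨hl.1.trans_le ht.1, ht.2⟩
    have h1 : ∫ t in Ioc l x, g t0 * t⁻¹ = g t0 * (Real.log x - Real.log l) := by
      rw [← intervalIntegral.integral_of_le hl.2.le, intervalIntegral.integral_const_mul,
        integral_inv_of_pos hl.1 hx, Real.log_div hx.ne' hl.1.ne']
    rw [← h1]
    apply setIntegral_mono_on _ _ measurableSet_Ioc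
    · intro t ht
      have ht' := hsub (Ioc_subset_Icc_self ht)
      rw [hm t ht']
      exact mul_le_mul_of_nonneg_right (hmin (Ioc_subset_Icc_self ht')) (inv_nonneg.2 ht'.1.le)
    · have : ContinuousOn (fun t : ℝ => g t0 * t⁻¹) (Icc l x) :=
        continuousOn_const.mul (continuousOn_id.inv₀ (fun t ht => ne_of_gt (hsub ht).1))
      exact this.integrableOn_Icc.mono_set Ioc_subset_Icc_self
    · exact (hmc.mono hsub).integrableOn_Icc.mono_set Ioc_subset_Icc_self
  · obtain ⟨K, hK⟩ := isCompact_Icc.exists_bound_of_continuousOn hf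
    obtain ⟨B, hB⟩ := isCompact_Icc.exists_bound_of_continuousOn hg
    have hS : ContinuousOn (fun t => ∫ η in Ioc 0 t, f η) (Icc 0 x) :=
      intervalIntegral.continuousOn_primitive hf.integrableOn_Icc
    have hmeas := ((hS.mono Ioc_subset_Icc_self).mul hmc).aestronglyMeasurable
      (μ := volume) measurableSet_Ioc
    refine IntegrableOn.of_bound measure_Ioc_lt_top hmeas (K * B) ?_
    filter_upwards [ae_restrict_mem measurableSet_Ioc] with t ht
    have h1 : ‖∫ η in Ioc 0 t, f η‖ ≤ K * t := by
      have := norm_setIntegral_le_of_norm_le_const (μ := volume) (s := Ioc 0 t) (f := f) (C := K)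
        measure_Ioc_lt_top (fun η hη => hK η ⟨hη.1.le, hη.2.trans ht.2⟩)
      simpa [Measure.real, ht.1.le] using this
    have hK0 : 0 ≤ K := (norm_nonneg _).trans (hK t ⟨ht.1.le, ht.2⟩)
    have h2 := hB t ⟨ht.1.le, ht.2⟩
    have h3 : ‖m t‖ = ‖g t‖ * t⁻¹ := by
      rw [hm t ht, norm_mul, Real.norm_of_nonneg (inv_nonneg.2 ht.1.le)]
    rw [norm_mul, h3]
    have hti : 0 ≤ t⁻¹ := inv_nonneg.2 ht.1.le
    calc _ ≤ (K * t) * (B * t⁻¹) := by gcongr; exact mul_nonneg hK0 ht.1.le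
      _ = K * B := by have := ht.1.ne'; field_simp

/-- For the generalized Feller diffusion, `M(0,x] = ∞` and `Σ(0) < ∞`: the boundary
point `0` is an exit boundary. -/
theorem feller_diffusion_zero_exit (μ κ σ γ a : ℝ)
    (hμ : 0 < μ) (hκ : 0 < κ) (hσ : 0 < σ) (hγ : 0 < γ) (ha : 0 < a)
    (x : ℝ) (hx : 0 < x) :
    Tendsto (fun l => ∫ ξ in Ioc l x, speedDens μ κ σ γ a ξ)
      (nhdsWithin 0 (Ioi 0)) atTop ∧
    IntegrableOn
      (fun ξ => (∫ η in Ioc 0 ξ, scaleDeriv μ κ σ γ a η) * speedDens μ κ σ γ a ξ)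
      (Ioc 0 x) := by
  have hσ2 : 0 < σ ^ 2 := by positivity
  have hA : 0 < γ + σ ^ 2 * a := by positivity
  have hP : ∀ t ∈ Icc 0 x, 0 < γ + σ ^ 2 * t := fun t ht => by
    have := mul_nonneg hσ2.le ht.1
    linarith
  have hQ : ∀ t ∈ Icc 0 x, 0 < (γ + σ ^ 2 * t) / (γ + σ ^ 2 * a) :=
    fun t ht => div_pos (hP t ht) hA
  have hr : ∀ p : ℝ, ContinuousOn (fun t => ((γ + σ ^ 2 * t) / (γ + σ ^ 2 * a)) ^ p) (Icc 0 x) :=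
    fun p => ContinuousOn.rpow_const (by fun_prop) (fun t ht => Or.inl (hQ t ht).ne')
  refine aux_exit (scaleDeriv μ κ σ γ a)
    (fun ξ => ((γ + σ ^ 2 * ξ) / (γ + σ ^ 2 * a)) ^ (2 * (μ / σ ^ 2 + γ * κ / σ ^ 4)) *
      Real.exp (-(2 * κ / σ ^ 2) * (ξ - a)) / (γ + σ ^ 2 * ξ))
    (speedDens μ κ σ γ a) x hx ?_ ?_ ?_ ?_
  · exact (hr _).mul (by fun_prop)
  · exact ((hr _).mul (by fun_prop)).div (by fun_prop) (fun t ht => (hP t ht).ne')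
  · intro t ht
    exact div_pos (mul_pos (Real.rpow_pos_of_pos (hQ t ht) _) (Real.exp_pos _)) (hP t ht)
  · intro t ht
    have h1 : γ * t + σ ^ 2 * t ^ 2 = (γ + σ ^ 2 * t) * t := by ring
    simp only [speedDens]
    rw [h1, ← div_div, div_eq_mul_inv _ t]
end

section
/- Let μ, κ, σ, γ, a > 0 and set C := 2(μ/σ² + γκ/σ⁴) and D := 2κ/σ². Define s'(η) := ((γ+σ²η)/(γ+σ²a))^{−C} e^{D(η−a)} and m(ξ) := ((γ+σ²ξ)/(γ+σ²a))^{C} e^{−D(ξ−a)} / (γξ + σ²ξ²) for ξ, η > 0. Then for every x > 0 and c > 0: (i) ∫_x^∞ ( ∫_η^∞ m(ξ) dξ ) s'(η) dη < ∞; and (ii) ∫_c^∞ s'(y) dy = ∞. -/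
open MeasureTheory Set Filter

noncomputable def FF (C D s γ a ξ : ℝ) : ℝ :=
  ((γ + s * ξ) / (γ + s * a)) ^ C * Real.exp (-D * (ξ - a))

lemma FF_pos {C D s γ a ξ : ℝ} (hs : 0 < s) (hγ : 0 < γ) (ha : 0 < a) (hξ : 0 < ξ) :
    0 < FF C D s γ a ξ := by
  unfold FF
  positivity

lemma FF_bound {C D s γ a : ℝ} (hC : 0 < C) (hD : 0 < D) (hs : 0 < s) (hγ : 0 < γ)
    (ha : 0 < a) : ∃ K > 0, ∀ η ξ, 0 < η → η ≤ ξ →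
      FF C D s γ a ξ ≤ K * FF C D s γ a η * Real.exp (-(D / 2) * (ξ - η)) := by
  set ε := D / (2 * C) with hε
  have hε0 : 0 < ε := by positivity
  set M := 1 + s / γ / ε with hM
  have hM0 : 0 < M := by positivity
  refine ⟨M ^ C, by positivity, fun η ξ hη hξ => ?_⟩
  have hξ0 : 0 < ξ := hη.trans_le hξ
  have h1 : γ + s * ξ ≤ (M * Real.exp (ε * (ξ - η))) * (γ + s * η) := by
    have e1 : 1 + ε * (ξ - η) ≤ Real.exp (ε * (ξ - η)) := by
      linarith [Real.add_one_le_exp (ε * (ξ - η))]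
    have t0 : 0 ≤ ξ - η := by linarith
    have e2 : (M * (1 + ε * (ξ - η))) * (γ + s * η) ≤
        (M * Real.exp (ε * (ξ - η))) * (γ + s * η) := by gcongr
    refine le_trans ?_ e2
    have e3 : M * (1 + ε * (ξ - η)) = 1 + s / γ * (ξ - η) + s / γ / ε + ε * (ξ - η) := by
      rw [hM]; field_simp; ring
    have e4 : 1 + s / γ * (ξ - η) ≤ M * (1 + ε * (ξ - η)) := by
      rw [e3]
      have : 0 ≤ s / γ / ε + ε * (ξ - η) := by positivity
      linarith
    have e5 : (1 + s / γ * (ξ - η)) * (γ + s * η) ≤ (M * (1 + ε * (ξ - η))) * (γ + s * η) := by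
      gcongr
    refine le_trans ?_ e5
    have e6 : (1 + s / γ * (ξ - η)) * (γ + s * η)
        = γ + s * ξ + s / γ * (ξ - η) * (s * η) := by
      field_simp; ring
    rw [e6]
    have : 0 ≤ s / γ * (ξ - η) * (s * η) := by positivity
    linarith
  have h2 : ((γ + s * ξ) / (γ + s * a)) ^ C ≤
      M ^ C * Real.exp (D / 2 * (ξ - η)) * ((γ + s * η) / (γ + s * a)) ^ C := by
    have : (γ + s * ξ) / (γ + s * a) ≤
        (M * Real.exp (ε * (ξ - η))) * ((γ + s * η) / (γ + s * a)) := by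
      rw [← mul_div_assoc]; gcongr
    refine (Real.rpow_le_rpow (by positivity) this hC.le).trans_eq ?_
    rw [Real.mul_rpow (by positivity) (by positivity), Real.mul_rpow (by positivity) (by positivity),
      ← Real.exp_mul]
    congr 3
    rw [hε]; field_simp
  unfold FF
  calc _ ≤ (M ^ C * Real.exp (D / 2 * (ξ - η)) * ((γ + s * η) / (γ + s * a)) ^ C)
        * Real.exp (-D * (ξ - a)) := by gcongr
    _ = M ^ C * ((γ + s * η) / (γ + s * a)) ^ C *
        (Real.exp (D / 2 * (ξ - η)) * Real.exp (-D * (ξ - a))) := by ring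
    _ = M ^ C * ((γ + s * η) / (γ + s * a)) ^ C *
        (Real.exp (-D * (η - a)) * Real.exp (-(D / 2) * (ξ - η))) := by
        rw [← Real.exp_add, ← Real.exp_add]; congr 2; ring
    _ = _ := by ring

/-- For the generalized Feller diffusion, `N̄(∞) < ∞` and `s(∞) = ∞`: the boundary
point `∞` is an entrance boundary. -/
theorem feller_diffusion_infinity_entrance (μ κ σ γ a : ℝ)
    (hμ : 0 < μ) (hκ : 0 < κ) (hσ : 0 < σ) (hγ : 0 < γ) (ha : 0 < a)
    (x c : ℝ) (hx : 0 < x) (hc : 0 < c) :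
    IntegrableOn
      (fun η => (∫ ξ in Ioi η, speedDens μ κ σ γ a ξ) * scaleDeriv μ κ σ γ a η)
      (Ioi x) ∧
    ¬ IntegrableOn (fun y => scaleDeriv μ κ σ γ a y) (Ioi c) := by
  set C := 2 * (μ / σ ^ 2 + γ * κ / σ ^ 4) with hCdef
  set D := 2 * κ / σ ^ 2 with hDdef
  have hC : 0 < C := by positivity
  have hD : 0 < D := by positivity
  have hs : 0 < σ ^ 2 := by positivity
  set F := FF C D (σ ^ 2) γ a with hF
  have hFpos : ∀ y, 0 < y → 0 < F y := fun y hy => FF_pos hs hγ ha hy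
  have hm : ∀ y, speedDens μ κ σ γ a y = F y / (γ * y + σ ^ 2 * y ^ 2) := fun y => rfl
  have hsd : ∀ y, 0 < y → scaleDeriv μ κ σ γ a y = (F y)⁻¹ := by
    intro y hy
    simp only [scaleDeriv, hF, FF]
    rw [mul_inv, ← Real.exp_neg, Real.rpow_neg (by positivity)]
    congr 2
    rw [hDdef]; ring
  have hsdm : Measurable (scaleDeriv μ κ σ γ a) := by
    unfold scaleDeriv; fun_prop
  have hmm : Measurable (speedDens μ κ σ γ a) := by
    unfold speedDens; fun_prop
  obtain ⟨K, hK, hb⟩ := FF_bound (C := C) (D := D) (a := a) hC hD hs hγ ha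
  have hmpos : ∀ y, 0 < y → 0 ≤ speedDens μ κ σ γ a y := by
    intro y hy
    rw [hm]
    have := hFpos y hy
    positivity
  have hmb : ∀ η ξ, 0 < η → η ≤ ξ → speedDens μ κ σ γ a ξ ≤
      (K * F η / (σ ^ 2 * η ^ 2) * Real.exp (D / 2 * η)) * Real.exp (-(D / 2) * ξ) := by
    intro η ξ hη hξ
    have hξ0 : 0 < ξ := hη.trans_le hξ
    have h1 := hb η ξ hη hξ
    have hFη := hFpos η hη
    have h2 : σ ^ 2 * η ^ 2 ≤ γ * ξ + σ ^ 2 * ξ ^ 2 := by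
      have : σ ^ 2 * η ^ 2 ≤ σ ^ 2 * ξ ^ 2 := by gcongr
      have : 0 < γ * ξ := by positivity
      linarith
    rw [hm]
    calc _ ≤ (K * F η * Real.exp (-(D / 2) * (ξ - η))) / (σ ^ 2 * η ^ 2) := by
          gcongr
      _ = _ := by
          rw [show -(D / 2) * (ξ - η) = D / 2 * η + -(D / 2) * ξ by ring, Real.exp_add]; ring
  have hexp : ∀ η : ℝ, IntegrableOn (fun ξ => Real.exp (-(D / 2) * ξ)) (Ioi η) := fun η =>
    integrableOn_exp_mul_Ioi (by linarith) η
  have hmi : ∀ η, 0 < η → IntegrableOn (speedDens μ κ σ γ a) (Ioi η) := by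
    intro η hη
    refine Integrable.mono' ((hexp η).const_mul
      (K * F η / (σ ^ 2 * η ^ 2) * Real.exp (D / 2 * η))) hmm.aestronglyMeasurable ?_
    filter_upwards [ae_restrict_mem measurableSet_Ioi] with ξ hξ
    rw [Real.norm_of_nonneg (hmpos ξ (hη.trans hξ))]
    exact hmb η ξ hη (le_of_lt hξ)
  have hG0 : ∀ η, 0 < η → 0 ≤ ∫ ξ in Ioi η, speedDens μ κ σ γ a ξ := fun η hη =>
    setIntegral_nonneg measurableSet_Ioi fun ξ hξ => hmpos ξ (hη.trans hξ)
  have hG : ∀ η, 0 < η → ∫ ξ in Ioi η, speedDens μ κ σ γ a ξ ≤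
      K * F η / (σ ^ 2 * η ^ 2) * (2 / D) := by
    intro η hη
    have h1 := setIntegral_mono_on (hmi η hη) ((hexp η).const_mul
      (K * F η / (σ ^ 2 * η ^ 2) * Real.exp (D / 2 * η))) measurableSet_Ioi
      fun ξ hξ => hmb η ξ hη (le_of_lt hξ)
    refine h1.trans_eq ?_
    rw [integral_const_mul, integral_exp_mul_Ioi (by linarith)]
    have : Real.exp (D / 2 * η) * Real.exp (-(D / 2) * η) = 1 := by
      rw [← Real.exp_add]; simp
    calc _ = K * F η / (σ ^ 2 * η ^ 2) * (2 / D) *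
          (Real.exp (D / 2 * η) * Real.exp (-(D / 2) * η)) := by
          field_simp
      _ = _ := by rw [this, mul_one]
  constructor
  · have hanti : AntitoneOn (fun η => ∫ ξ in Ioi η, speedDens μ κ σ γ a ξ) (Ioi x) := by
      intro p hp q hq hpq
      refine setIntegral_mono_set (hmi p (hx.trans hp)) ?_ (Ioi_subset_Ioi hpq).eventuallyLE
      filter_upwards [ae_restrict_mem measurableSet_Ioi] with ξ hξ
      exact hmpos ξ ((hx.trans hp).trans hξ)
    have hmeas := aemeasurable_restrict_of_antitoneOn (μ := volume) measurableSet_Ioi hanti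
    have hr : IntegrableOn (fun η : ℝ => η ^ (-2 : ℝ)) (Ioi x) :=
      integrableOn_Ioi_rpow_of_lt (by norm_num) hx
    refine Integrable.mono' (hr.const_mul (K / σ ^ 2 * (2 / D)))
      (hmeas.mul hsdm.aemeasurable).aestronglyMeasurable ?_
    filter_upwards [ae_restrict_mem measurableSet_Ioi] with η hη
    have hη0 : 0 < η := hx.trans hη
    have hFη := hFpos η hη0
    rw [hsd η hη0, Real.norm_of_nonneg (mul_nonneg (hG0 η hη0) (by positivity))]
    calc _ ≤ K * F η / (σ ^ 2 * η ^ 2) * (2 / D) * (F η)⁻¹ := by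
          gcongr; exact hG η hη0
      _ = _ := by
          rw [Real.rpow_neg hη0.le, Real.rpow_two]; field_simp
  · intro hI
    have hFc := hFpos c hc
    have hcst : IntegrableOn (fun _ : ℝ => (K * F c)⁻¹) (Ioi c) := by
      refine Integrable.mono' hI aestronglyMeasurable_const ?_
      filter_upwards [ae_restrict_mem measurableSet_Ioi] with η hη
      have hη0 : 0 < η := hc.trans hη
      have hFη := hFpos η hη0
      rw [hsd η hη0, Real.norm_of_nonneg (by positivity)]
      gcongr
      refine (hb c η hc (le_of_lt hη)).trans ?_
      refine mul_le_of_le_one_right (by positivity) ?_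
      rw [Real.exp_le_one_iff]
      have : 0 < η - c := sub_pos.2 hη
      nlinarith
    rw [integrableOn_const_iff] at hcst
    have : (K * F c)⁻¹ ≠ 0 := by positivity
    simp [this] at hcst
    rcases hcst with h | h <;> linarith
end

section
/- Let A, a, σ > 0 and define ρ̃(x) := exp( 2Ax − (2a/σ) e^{σx} ) for x ∈ ℝ. Then: (i) ∫_{−∞}^{∞} ρ̃(x) dx < ∞; (ii) ∫_{−∞}^0 ρ̃(t) ( ∫_t^0 ρ̃(s)⁻¹ ds ) dt = ∞ and ∫_{−∞}^0 ρ̃(t)⁻¹ ( ∫_t^0 ρ̃(s) ds ) dt = ∞; (iii) ∫_0^∞ ρ̃(t) ( ∫_0^t ρ̃(s)⁻¹ ds ) dt < ∞. -/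
open MeasureTheory Set

theorem tlb_not_int (f : ℝ → ℝ) (k : ℝ) (hk : 0 < k) (h : ∀ t, t < -1 → k ≤ f t) :
    ¬ IntegrableOn f (Iio 0) := by
  intro hf
  have h1 : IntegrableOn f (Iio (-1)) := hf.mono_set (Iio_subset_Iio (by norm_num))
  have h2 : IntegrableOn (fun _ : ℝ => k) (Iio (-1)) := by
    refine Integrable.mono' h1 aestronglyMeasurable_const ?_
    filter_upwards [ae_restrict_mem measurableSet_Iio] with t ht
    rw [Real.norm_eq_abs, abs_of_pos hk]
    exact h t ht
  rw [integrableOn_const_iff] at h2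
  rcases h2 with h2 | h2
  · exact hk.ne' (by simpa using h2)
  · simp at h2

/-- lower bound for integrals over a unit subinterval -/
theorem tlb_lower (f : ℝ → ℝ) (hf : Continuous f) (h0 : ∀ x, 0 ≤ f x) (t b k : ℝ)
    (ht : t ≤ b) (hb : b ≤ -1) (h : ∀ s, b < s → s ≤ b + 1 → k ≤ f s) :
    k ≤ ∫ s in Ioc t 0, f s := by
  have h1 : ∫ s in Ioc b (b+1), f s ≤ ∫ s in Ioc t 0, f s := by
    apply setIntegral_mono_set
    · exact (hf.integrableOn_Icc).mono_set Ioc_subset_Icc_self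
    · exact Filter.Eventually.of_forall h0
    · exact (Ioc_subset_Ioc ht (by linarith)).eventuallyLE
  have h2 : ∫ s in Ioc b (b+1), k ≤ ∫ s in Ioc b (b+1), f s := by
    apply setIntegral_mono_on
    · exact integrableOn_const (by simp)
    · exact (hf.integrableOn_Icc).mono_set Ioc_subset_Icc_self
    · exact measurableSet_Ioc
    · intro x hx
      exact h x hx.1 hx.2
  have h3 : ∫ s in Ioc b (b+1), k = k := by simp
  linarith

theorem tlb_int (A c σ : ℝ) (hA : 0 < A) (hc : 0 < c) (hσ : 0 < σ) :
    Integrable (fun x => Real.exp (2 * A * x - c * Real.exp (σ * x))) := by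
  have hcont : Continuous (fun x => Real.exp (2 * A * x - c * Real.exp (σ * x))) := by
    fun_prop
  rw [← integrableOn_univ, ← Iic_union_Ioi (a := (0:ℝ))]
  apply IntegrableOn.union
  · refine Integrable.mono' (g := fun x => Real.exp (2 * A * x))
      (integrableOn_exp_mul_Iic (by linarith) 0) hcont.aestronglyMeasurable ?_
    refine Filter.Eventually.of_forall fun x => ?_
    rw [Real.norm_eq_abs, Real.abs_exp]
    apply Real.exp_le_exp.2
    have := mul_pos hc (Real.exp_pos (σ * x))
    linarith
  · have hb : 0 < c * σ ^ 2 / 2 := by positivity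
    refine Integrable.mono'
      (g := fun x => Real.exp ((2 * A + 1) ^ 2 / (4 * (c * σ ^ 2 / 2))) * Real.exp (-1 * x))
      ((integrableOn_exp_mul_Ioi (by norm_num) 0).const_mul _) hcont.aestronglyMeasurable ?_
    filter_upwards [ae_restrict_mem measurableSet_Ioi] with x hx
    have hx : 0 < x := hx
    rw [Real.norm_eq_abs, Real.abs_exp, ← Real.exp_add]
    apply Real.exp_le_exp.2
    have h1 := Real.quadratic_le_exp_of_nonneg (x := σ * x) (by positivity)
    have h2 : c * (σ * x) ^ 2 / 2 ≤ c * Real.exp (σ * x) := by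
      have : 0 < σ * x := by positivity
      have h3 : (σ * x) ^ 2 / 2 ≤ Real.exp (σ * x) := by linarith
      have := mul_le_mul_of_nonneg_left h3 hc.le
      linarith
    have h4 : (2 * A + 1) * x - (c * σ ^ 2 / 2) * x ^ 2
        ≤ (2 * A + 1) ^ 2 / (4 * (c * σ ^ 2 / 2)) := by
      generalize c * σ ^ 2 / 2 = b at hb
      rw [le_div_iff₀ (by positivity)]
      nlinarith [sq_nonneg (2 * b * x - (2 * A + 1))]
    have : c * (σ * x) ^ 2 / 2 = (c * σ ^ 2 / 2) * x ^ 2 := by ring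
    linarith

theorem tlb_three (A a σ : ℝ) (hA : 0 < A) (ha : 0 < a) (hσ : 0 < σ)
    (ρ : ℝ → ℝ) (hρ : ∀ x, ρ x = Real.exp (2 * A * x - 2 * a / σ * Real.exp (σ * x)))
    (hi : Integrable ρ) :
    IntegrableOn (fun t => ρ t * ∫ s in Ioc 0 t, (ρ s)⁻¹) (Ioi 0) := by
  have hfun : ρ = fun x => Real.exp (2 * A * x - 2 * a / σ * Real.exp (σ * x)) := funext hρ
  have hcont : Continuous ρ := by rw [hfun]; fun_prop
  have hpos : ∀ x, 0 < ρ x := fun x => by rw [hρ]; exact Real.exp_pos _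
  have hicont : Continuous (fun x => (ρ x)⁻¹) := hcont.inv₀ fun x => (hpos x).ne'
  have hipos : ∀ x, 0 < (ρ x)⁻¹ := fun x => inv_pos.2 (hpos x)
  set I : ℝ → ℝ := fun t => ∫ s in (0:ℝ)..t, (ρ s)⁻¹ with hI
  have hId : ∀ t, HasDerivAt I (ρ t)⁻¹ t := fun t =>
    intervalIntegral.integral_hasDerivAt_right (hicont.intervalIntegrable _ _)
      hicont.aestronglyMeasurable.stronglyMeasurableAtFilter hicont.continuousAt
  have hIcont : Continuous I := continuous_iff_continuousAt.2 fun t => (hId t).continuousAt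
  have hImono : Monotone I := monotone_of_deriv_nonneg (fun t => (hId t).differentiableAt)
    fun t => by rw [(hId t).deriv]; exact (hipos t).le
  have hI0 : I 0 = 0 := by simp [hI]
  -- choose T
  obtain ⟨T, hT0, hT⟩ : ∃ T : ℝ, 0 ≤ T ∧ ∀ t, T ≤ t → σ + 2 * A ≤ a * Real.exp (σ * t) := by
    refine ⟨(σ + 2 * A) / (a * σ), by positivity, fun t ht => ?_⟩
    rw [div_le_iff₀ (by positivity)] at ht
    have := Real.add_one_le_exp (σ * t)
    nlinarith
  set E : ℝ → ℝ := fun t => 1 / a *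
    Real.exp (-σ * t - (2 * A * t - 2 * a / σ * Real.exp (σ * t))) with hE
  have hEρ : ∀ t, ρ t * E t = 1 / a * Real.exp (-σ * t) := fun t => by
    rw [hE, hρ]
    rw [mul_left_comm, ← Real.exp_add]
    congr 2; ring
  have hEd : ∀ t, HasDerivAt E (E t * (-σ - (2 * A - 2 * a * Real.exp (σ * t)))) t := fun t => by
    have h1 : HasDerivAt (fun t => Real.exp (σ * t)) (Real.exp (σ * t) * (σ * 1)) t :=
      ((hasDerivAt_id t).const_mul σ).exp
    have h2 := (((((hasDerivAt_id t).const_mul (-σ)).sub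
      (((hasDerivAt_id t).const_mul (2 * A)).sub (h1.const_mul (2 * a / σ)))).exp).const_mul (1 / a))
    refine HasDerivAt.congr_deriv (f := E) h2 ?_
    have h3 : 2 * a / σ * (Real.exp (σ * t) * (σ * 1)) = 2 * a * Real.exp (σ * t) := by
      field_simp
    rw [h3, mul_one, mul_one, ← mul_assoc]
    rfl
  have hanti : AntitoneOn (fun t => I t - E t) (Ici T) := by
    have hd : ∀ t, HasDerivAt (fun t => I t - E t) _ t := fun t => (hId t).sub (hEd t)
    apply antitoneOn_of_deriv_nonpos (convex_Ici T)
    · exact fun t _ => (hd t).continuousAt.continuousWithinAt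
    · exact fun t _ => (hd t).differentiableAt.differentiableWithinAt
    · intro t ht
      rw [interior_Ici] at ht
      rw [(hd t).deriv]
      have h1 := hT t (le_of_lt ht)
      have h2 : E t = (ρ t)⁻¹ * (1 / a * Real.exp (-σ * t)) := by
        rw [← hEρ, inv_mul_cancel_left₀ (hpos t).ne']
      have h3 : 0 < E t := by rw [hE]; positivity
      have h4 : E t * (a * Real.exp (σ * t)) = (ρ t)⁻¹ := by
        have : Real.exp (-σ * t) * Real.exp (σ * t) = 1 := by
          rw [← Real.exp_add]; simp
        rw [h2]
        calc _ = (ρ t)⁻¹ * (a / a) * (Real.exp (-σ * t) * Real.exp (σ * t)) := by ring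
          _ = _ := by rw [this, div_self ha.ne']; ring
      have h5 := mul_le_mul_of_nonneg_left h1 h3.le
      nlinarith
  have hKb : ∀ t, 0 < t → I t ≤ I T + E t := by
    intro t ht
    have hE0 : ∀ t, 0 < E t := fun t => by rw [hE]; positivity
    rcases le_total t T with h | h
    · linarith [hImono h, hE0 t]
    · have := hanti (mem_Ici.2 le_rfl) (mem_Ici.2 h) h
      simp only at this
      linarith [hE0 T]
  have hint : IntegrableOn (fun t => ρ t * I t) (Ioi 0) := by
    refine Integrable.mono' (g := fun t => ρ t * I T + 1 / a * Real.exp (-σ * t))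
      ((hi.mul_const _).integrableOn.add
        ((integrableOn_exp_mul_Ioi (by linarith) 0).const_mul _))
      (hcont.mul hIcont).aestronglyMeasurable ?_
    filter_upwards [ae_restrict_mem measurableSet_Ioi] with t ht
    have ht : 0 < t := ht
    have hIt : 0 ≤ I t := hI0 ▸ hImono ht.le
    rw [Real.norm_eq_abs, abs_of_nonneg (mul_nonneg (hpos t).le hIt), ← hEρ, ← mul_add]
    exact mul_le_mul_of_nonneg_left (hKb t ht) (hpos t).le
  refine hint.congr_fun (fun t ht => ?_) measurableSet_Ioi
  simp only [hI]
  rw [intervalIntegral.integral_of_le (le_of_lt ht)]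

/-- For the transformed logistic diffusion `dX = (A - ae^{σX})dt + dW` with
speed-measure density `ρ̃(x) = exp(2Ax - (2a/σ)e^{σx})`: the speed measure is finite,
`-∞` is a natural (inaccessible) boundary and `+∞` is an entrance boundary. -/
theorem transformed_logistic_boundaries (A a σ : ℝ) (hA : 0 < A) (ha : 0 < a)
    (hσ : 0 < σ)
    (ρ : ℝ → ℝ) (hρ : ∀ x, ρ x = Real.exp (2 * A * x - 2 * a / σ * Real.exp (σ * x))) :
    Integrable ρ ∧
    ((¬ IntegrableOn (fun t => ρ t * ∫ s in Ioc t 0, (ρ s)⁻¹) (Iio 0)) ∧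
      (¬ IntegrableOn (fun t => (ρ t)⁻¹ * ∫ s in Ioc t 0, ρ s) (Iio 0))) ∧
    IntegrableOn (fun t => ρ t * ∫ s in Ioc 0 t, (ρ s)⁻¹) (Ioi 0) := by
  have hfun : ρ = fun x => Real.exp (2 * A * x - 2 * a / σ * Real.exp (σ * x)) := funext hρ
  have hcont : Continuous ρ := by rw [hfun]; fun_prop
  have hpos : ∀ x, 0 < ρ x := fun x => by rw [hρ]; exact Real.exp_pos _
  have hicont : Continuous (fun x => (ρ x)⁻¹) := hcont.inv₀ fun x => (hpos x).ne'
  have hipos : ∀ x, 0 < (ρ x)⁻¹ := fun x => inv_pos.2 (hpos x)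
  have hc : 0 < 2 * a / σ := by positivity
  have hi : Integrable ρ := by
    rw [hfun]; exact tlb_int A (2 * a / σ) σ hA hc hσ
  have hup : ∀ s, ρ s ≤ Real.exp (2 * A * s) := fun s => by
    rw [hρ]
    apply Real.exp_le_exp.2
    have := mul_pos hc (Real.exp_pos (σ * s))
    linarith
  have hlo : ∀ s, s ≤ 0 → Real.exp (2 * A * s - 2 * a / σ) ≤ ρ s := fun s hs => by
    rw [hρ]
    apply Real.exp_le_exp.2
    have h1 : Real.exp (σ * s) ≤ 1 := Real.exp_le_one_iff.2 (by nlinarith)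
    have := mul_le_mul_of_nonneg_left h1 hc.le
    linarith
  refine ⟨hi, ⟨?_, ?_⟩, tlb_three A a σ hA ha hσ ρ hρ hi⟩
  · apply tlb_not_int _ (Real.exp (-2 * A - 2 * a / σ)) (Real.exp_pos _)
    intro t ht
    have h1 : Real.exp (-(2 * A * (t + 1))) ≤ ∫ s in Ioc t 0, (ρ s)⁻¹ := by
      apply tlb_lower _ hicont (fun x => (hipos x).le) t t _ le_rfl ht.le
      intro s _ hs
      rw [Real.exp_neg]
      apply inv_anti₀ (hpos s)
      refine (hup s).trans (Real.exp_le_exp.2 ?_)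
      nlinarith
    have h2 := mul_le_mul (hlo t (by linarith)) h1 (Real.exp_pos _).le (hpos t).le
    rw [← Real.exp_add] at h2
    refine le_trans (Real.exp_le_exp.2 (le_of_eq ?_)) h2
    ring
  · apply tlb_not_int _ (Real.exp (-2 * A - 2 * a / σ)) (Real.exp_pos _)
    intro t ht
    have h1 : Real.exp (-2 * A - 2 * a / σ) ≤ ∫ s in Ioc t 0, ρ s := by
      apply tlb_lower _ hcont (fun x => (hpos x).le) t (-1) _ ht.le le_rfl
      intro s hs hs'
      refine le_trans (Real.exp_le_exp.2 ?_) (hlo s (by linarith))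
      nlinarith
    have h2 : 1 ≤ (ρ t)⁻¹ := by
      apply (one_le_inv₀ (hpos t)).2
      exact (hup t).trans (Real.exp_le_one_iff.2 (by nlinarith))
    have h3 := mul_le_mul h2 h1 (Real.exp_pos _).le (hipos t).le
    rwa [one_mul] at h3
end

section
/- For all t > 0, x > 0 and y ∈ (0,1], (1/√(2πt)) · ( exp(−(x−y)²/(2t)) − exp(−(x+y)²/(2t)) ) ≤ ( y/√(2πt) ) · exp(−x²/(2t)) · exp(x/t). -/
open Real

lemma sinh_mul_le_aux (a y : ℝ) (ha : 0 < a) (hy : 0 < y) (hy1 : y ≤ 1) :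
    Real.sinh (y * a) ≤ y * Real.sinh a := by
  have hd : ∀ s : ℝ, HasDerivAt (fun s => y * Real.sinh s - Real.sinh (y * s))
      (y * Real.cosh s - Real.cosh (y * s) * (y * 1)) s := fun s =>
    ((Real.hasDerivAt_sinh s).const_mul y).sub (((hasDerivAt_id s).const_mul y).sinh)
  have hm : MonotoneOn (fun s => y * Real.sinh s - Real.sinh (y * s)) (Set.Ici 0) := by
    apply monotoneOn_of_deriv_nonneg (convex_Ici 0)
    · exact fun s _ => (hd s).continuousAt.continuousWithinAt
    · exact fun s _ => (hd s).differentiableAt.differentiableWithinAt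
    · intro s hs
      rw [interior_Ici] at hs
      have hs' : 0 < s := hs
      rw [(hd s).deriv]
      have : Real.cosh (y * s) ≤ Real.cosh s := by
        rw [Real.cosh_le_cosh, abs_of_pos hs', abs_of_pos (by positivity)]
        nlinarith
      nlinarith
  have h := hm (Set.mem_Ici.2 le_rfl) (Set.mem_Ici.2 ha.le) ha.le
  simp at h
  linarith

/-- Dirichlet heat kernel bound on `(0,∞)`:
`p^D(t,x,y) ≤ (y/√(2πt)) e^{-x²/(2t)} e^{x/t}` for `t > 0`, `x > 0`, `y ∈ (0,1]`. -/
theorem dirichlet_heat_kernel_bound (t x y : ℝ) (ht : 0 < t) (hx : 0 < x)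
    (hy : y ∈ Set.Ioc (0:ℝ) 1) :
    1 / Real.sqrt (2 * Real.pi * t) *
        (Real.exp (-(x - y) ^ 2 / (2 * t)) - Real.exp (-(x + y) ^ 2 / (2 * t))) ≤
      y / Real.sqrt (2 * Real.pi * t) * Real.exp (-x ^ 2 / (2 * t)) *
        Real.exp (x / t) := by
  obtain ⟨hy0, hy1⟩ := hy
  have ha : 0 < x / t := by positivity
  have h := sinh_mul_le_aux (x / t) y ha hy0 hy1
  rw [Real.sinh_eq, Real.sinh_eq] at h
  have h1 : Real.exp (-(x - y) ^ 2 / (2 * t)) =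
      Real.exp (-x ^ 2 / (2 * t)) * Real.exp (-y ^ 2 / (2 * t)) * Real.exp (y * (x / t)) := by
    rw [← Real.exp_add, ← Real.exp_add]; congr 1; field_simp; ring
  have h2 : Real.exp (-(x + y) ^ 2 / (2 * t)) =
      Real.exp (-x ^ 2 / (2 * t)) * Real.exp (-y ^ 2 / (2 * t)) * Real.exp (-(y * (x / t))) := by
    rw [← Real.exp_add, ← Real.exp_add]; congr 1; field_simp; ring
  have h3 : Real.exp (-y ^ 2 / (2 * t)) ≤ 1 := by
    rw [Real.exp_le_one_iff, neg_div]
    have : 0 ≤ y ^ 2 / (2 * t) := by positivity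
    linarith
  have h4 : Real.exp (y * (x / t)) - Real.exp (-(y * (x / t))) ≤ y * Real.exp (x / t) := by
    have := mul_pos hy0 (Real.exp_pos (-(x / t)))
    nlinarith
  have h5 : Real.exp (-y ^ 2 / (2 * t)) *
      (Real.exp (y * (x / t)) - Real.exp (-(y * (x / t)))) ≤ 1 * (y * Real.exp (x / t)) := by
    calc _ ≤ Real.exp (-y ^ 2 / (2 * t)) * (y * Real.exp (x / t)) := by gcongr
      _ ≤ _ := by gcongr
  rw [h1, h2]
  calc _ = 1 / Real.sqrt (2 * Real.pi * t) * Real.exp (-x ^ 2 / (2 * t)) *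
        (Real.exp (-y ^ 2 / (2 * t)) *
      (Real.exp (y * (x / t)) - Real.exp (-(y * (x / t))))) := by ring
    _ ≤ 1 / Real.sqrt (2 * Real.pi * t) * Real.exp (-x ^ 2 / (2 * t)) *
        (1 * (y * Real.exp (x / t))) := by gcongr
    _ = _ := by ring
end
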